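/- arXiv:2510.03877 — 4 statements merged into one kernel-verified Lean document; each statement's English description precedes it below -/
import Mathlib

section
/- If σ ∈ ker g is Killing (𝓛_σ g = 0), then f•σ is Killing for every f ∈ R. (If any generator of the kernel line bundle of a Carrollian Lie algebroid is Killing, then every section of the kernel is Killing.) -/
/-- If `σ ∈ ker g` is Killing, then `f • σ` is Killing for every `f ∈ R`. -/
theorem killing_frame_implies_all_killing
    (R A : Type*) [CommRing R] [LieRing A] [Module R A]
    (ρ : A → R → R)
    (hρadd : ∀ (u : A) (f₁ f₂ : R), ρ u (f₁ + f₂) = ρ u f₁ + ρ u f₂)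
    (hρder : ∀ (u : A) (f₁ f₂ : R), ρ u (f₁ * f₂) = ρ u f₁ * f₂ + f₁ * ρ u f₂)
    (hρaddA : ∀ (u u' : A) (f : R), ρ (u + u') f = ρ u f + ρ u' f)
    (hρsmul : ∀ (f : R) (u : A) (f' : R), ρ (f • u) f' = f * ρ u f')
    (hleib : ∀ (u v : A) (f : R), ⁅u, f • v⁆ = ρ u f • v + f • ⁅u, v⁆)
    (g : A → A → R)
    (hgsymm : ∀ v w, g v w = g w v)
    (hgadd : ∀ u v w, g (u + v) w = g u w + g v w)
    (hgsmul : ∀ (f : R) (v w : A), g (f • v) w = f * g v w)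
    (σ : A)
    (hker : ∀ v : A, g σ v = 0)
    (hkilling : ∀ v w : A, ρ σ (g v w) - g ⁅σ, v⁆ w - g v ⁅σ, w⁆ = 0) :
    ∀ (f : R) (v w : A),
      ρ (f • σ) (g v w) - g ⁅f • σ, v⁆ w - g v ⁅f • σ, w⁆ = 0 := by
  intro f v w
  have hbracket (v : A) : ⁅f • σ, v⁆ = (-ρ v f) • σ + f • ⁅σ, v⁆ := by
    rw [← lie_skew, hleib, ← lie_skew σ v, neg_add, neg_smul, smul_neg]
  have hmetric (v w : A) : g ⁅f • σ, v⁆ w = f * g ⁅σ, v⁆ w := by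
    rw [hbracket, hgadd, hgsmul, hgsmul, hker, mul_zero, zero_add]
  rw [hρsmul, hmetric, hgsymm v ⁅f • σ, w⁆, hmetric, hgsymm _ v]
  linear_combination f * hkilling v w
end

section
/- If A is a faithful R-module (f•w = 0 for all w ∈ A implies f = 0), then the anchor is automatically a Lie homomorphism: ρ_{⁅u,v⁆}(f) = ρ_u(ρ_v(f)) − ρ_v(ρ_u(f)) for all u, v ∈ A and f ∈ R. -/
/-- If `A` is a faithful `R`-module, then the anchor is automatically a
Lie homomorphism: `ρ_{⁅u,v⁆} f = ρ_u (ρ_v f) − ρ_v (ρ_u f)`. -/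
theorem anchor_is_lie_hom_of_faithful
    (R A : Type*) [CommRing R] [LieRing A] [Module R A]
    (ρ : A → R → R)
    (hρadd : ∀ (u : A) (f₁ f₂ : R), ρ u (f₁ + f₂) = ρ u f₁ + ρ u f₂)
    (hρder : ∀ (u : A) (f₁ f₂ : R), ρ u (f₁ * f₂) = ρ u f₁ * f₂ + f₁ * ρ u f₂)
    (hρaddA : ∀ (u u' : A) (f : R), ρ (u + u') f = ρ u f + ρ u' f)
    (hρsmul : ∀ (f : R) (u : A) (f' : R), ρ (f • u) f' = f * ρ u f')
    (hleib : ∀ (u v : A) (f : R), ⁅u, f • v⁆ = ρ u f • v + f • ⁅u, v⁆)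
    (hfaithful : ∀ f : R, (∀ w : A, f • w = 0) → f = 0) :
    ∀ (u v : A) (f : R), ρ ⁅u, v⁆ f = ρ u (ρ v f) - ρ v (ρ u f) := by
  intro u v f
  refine sub_eq_zero.mp (hfaithful _ fun w => ?_)
  have jacobi := lie_lie u v (f • w)
  simp only [hleib, lie_add] at jacobi
  rw [lie_lie u v w, smul_sub] at jacobi
  rw [sub_smul, sub_smul, sub_eq_zero]
  refine add_right_cancel (jacobi.trans ?_)
  abel
end

section
/- If a connection ∇ is metric compatible and torsion-free (T(u,v) = 0 for all u, v ∈ A), then every element of the kernel of g is Killing: for every u ∈ ker g and all v, w ∈ A one has ρ_u(g(v,w)) = g(⁅u,v⁆, w) + g(v, ⁅u,w⁆), i.e., 𝓛_u g = 0. (A Carrollian Lie algebroid admitting a torsion-free Carrollian connection is stationary.) -/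
/-- If `∇` is metric compatible and torsion-free, then every element of
`ker g` is Killing: `ρ_u(g(v,w)) = g(⁅u,v⁆,w) + g(v,⁅u,w⁆)` for `u ∈ ker g`. -/
theorem torsion_free_carrollian_implies_stationary
    (R A : Type*) [CommRing R] [LieRing A] [Module R A]
    (ρ : A → R → R)
    (hρadd : ∀ (u : A) (f₁ f₂ : R), ρ u (f₁ + f₂) = ρ u f₁ + ρ u f₂)
    (hρder : ∀ (u : A) (f₁ f₂ : R), ρ u (f₁ * f₂) = ρ u f₁ * f₂ + f₁ * ρ u f₂)
    (hρaddA : ∀ (u u' : A) (f : R), ρ (u + u') f = ρ u f + ρ u' f)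
    (hρsmul : ∀ (f : R) (u : A) (f' : R), ρ (f • u) f' = f * ρ u f')
    (hleib : ∀ (u v : A) (f : R), ⁅u, f • v⁆ = ρ u f • v + f • ⁅u, v⁆)
    (g : A → A → R)
    (hgsymm : ∀ v w, g v w = g w v)
    (hgadd : ∀ u v w, g (u + v) w = g u w + g v w)
    (hgsmul : ∀ (f : R) (v w : A), g (f • v) w = f * g v w)
    (D : A → A → A)
    (hDadd₁ : ∀ u u' v : A, D (u + u') v = D u v + D u' v)
    (hDadd₂ : ∀ u v v' : A, D u (v + v') = D u v + D u v')
    (hDsmul₁ : ∀ (f : R) (u v : A), D (f • u) v = f • D u v)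
    (hDsmul₂ : ∀ (f : R) (u v : A), D u (f • v) = f • D u v + ρ u f • v)
    (hmetric : ∀ u v w : A, ρ u (g v w) = g (D u v) w + g v (D u w))
    (htorsionfree : ∀ u v : A, D u v - D v u - ⁅u, v⁆ = 0) :
    ∀ u : A, (∀ v : A, g u v = 0) →
      ∀ v w : A, ρ u (g v w) = g ⁅u, v⁆ w + g v ⁅u, w⁆ := by
  intro u hu v w
  have hρ_zero (v : A) : ρ v 0 = 0 := by simpa using hρadd v 0 0
  have hD_ker (v w : A) : g (D v u) w = 0 := by
    have h := hmetric v u w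
    rw [hu w, hu (D v w), hρ_zero, add_zero] at h
    exact h.symm
  have hD (v : A) : D u v = D v u + ⁅u, v⁆ := by
    rw [← sub_eq_iff_eq_add', ← sub_eq_zero]
    exact htorsionfree u v
  rw [hmetric, hD v, hD w, hgadd, hD_ker, hgsymm v (D w u + _), hgadd, hD_ker,
    hgsymm _ v, zero_add, zero_add]
end

section
/- Let ∇ be a metric compatible connection and let u ∈ ker g be Killing (𝓛_u g = 0). Then the torsion of ∇ satisfies the algebraic constraint g(T(u,v), w) + g(v, T(u,w)) = 0 for all v, w ∈ A. (This is the consistency condition guaranteeing that, on a stationary Carrollian Lie algebroid, the torsion-free and metric-compatibility equations for the correction tensor are simultaneously solvable.) -/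
/-- If `∇` is metric compatible and `u ∈ ker g` is Killing, then the
torsion satisfies `g(T(u,v),w) + g(v,T(u,w)) = 0` for all `v, w`. -/
theorem killing_kernel_torsion_constraint
    (R A : Type*) [CommRing R] [LieRing A] [Module R A]
    (ρ : A → R → R)
    (hρadd : ∀ (u : A) (f₁ f₂ : R), ρ u (f₁ + f₂) = ρ u f₁ + ρ u f₂)
    (hρder : ∀ (u : A) (f₁ f₂ : R), ρ u (f₁ * f₂) = ρ u f₁ * f₂ + f₁ * ρ u f₂)
    (hρaddA : ∀ (u u' : A) (f : R), ρ (u + u') f = ρ u f + ρ u' f)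
    (hρsmul : ∀ (f : R) (u : A) (f' : R), ρ (f • u) f' = f * ρ u f')
    (hleib : ∀ (u v : A) (f : R), ⁅u, f • v⁆ = ρ u f • v + f • ⁅u, v⁆)
    (g : A → A → R)
    (hgsymm : ∀ v w, g v w = g w v)
    (hgadd : ∀ u v w, g (u + v) w = g u w + g v w)
    (hgsmul : ∀ (f : R) (v w : A), g (f • v) w = f * g v w)
    (D : A → A → A)
    (hDadd₁ : ∀ u u' v : A, D (u + u') v = D u v + D u' v)
    (hDadd₂ : ∀ u v v' : A, D u (v + v') = D u v + D u v')
    (hDsmul₁ : ∀ (f : R) (u v : A), D (f • u) v = f • D u v)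
    (hDsmul₂ : ∀ (f : R) (u v : A), D u (f • v) = f • D u v + ρ u f • v)
    (hmetric : ∀ u v w : A, ρ u (g v w) = g (D u v) w + g v (D u w))
    (u : A)
    (hker : ∀ v : A, g u v = 0)
    (hkilling : ∀ v w : A, ρ u (g v w) - g ⁅u, v⁆ w - g v ⁅u, w⁆ = 0) :
    ∀ v w : A,
      g (D u v - D v u - ⁅u, v⁆) w + g v (D u w - D w u - ⁅u, w⁆) = 0 := by
  intro v w
  have hsub (a b c : A) : g (a - b) c = g a c - g b c := by
    rw [eq_sub_iff_add_eq, ← hgadd, sub_add_cancel]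
  have hρzero (x : A) : ρ x 0 = 0 := by simpa using hρadd x 0 0
  have hker_D (x y : A) : g (D x u) y = 0 := by
    simpa [hker, hρzero] using (hmetric x u y).symm
  have hsub_right (a b c : A) : g a (b - c) = g a b - g a c := by
    rw [hgsymm, hsub, hgsymm b, hgsymm c]
  rw [hsub, hsub, hsub_right, hsub_right, hker_D, hgsymm v (D w u), hker_D]
  linear_combination hkilling v w - hmetric u v w
end
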